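/- arXiv:0811.3024 — 3 statements merged into one kernel-verified Lean document; each statement's English description precedes it below -/
import Mathlib

section
/- (Proposition 1, existence.) Let μ₀ be a Borel probability measure on ℝ and λ > 0. For t ≥ 0 define the measure μ_t = Σ_{n≥1} e^{−λt}(1−e^{−λt})^{n−1} μ₀^{*n} (the Wild sum), where μ₀^{*n} is the n-fold convolution of μ₀ with itself. Then each μ_t is a Borel probability measure on ℝ, and for every Borel set A ⊆ ℝ and every t ≥ 0, μ_t(A) = μ₀(A) + λ ∫₀ᵗ ( (μ_s ∗ μ_s)(A) − μ_s(A) ) ds, where ∗ denotes convolution of measures. -/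
open MeasureTheory

/-- `n`-fold convolution power of a measure on `ℝ`: `convPow μ 0 = δ₀` and
`convPow μ (n+1) = (convPow μ n) ∗ μ`. In particular `convPow μ 1 = δ₀ ∗ μ = μ`. -/
noncomputable def convPow (μ : Measure ℝ) : ℕ → Measure ℝ
  | 0 => Measure.dirac 0
  | n + 1 => Measure.conv (convPow μ n) μ

/-- The Wild sum `Σ_{n≥1} e^{−λt}(1−e^{−λt})^{n−1} μ₀^{*n}` (indexed here by `n : ℕ`,
so the `n`-th term carries coefficient `e^{−λt}(1−e^{−λt})^n` and the `(n+1)`-fold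
convolution power). -/
noncomputable def wildSum (μ₀ : Measure ℝ) (lam t : ℝ) : Measure ℝ :=
  Measure.sum fun n : ℕ =>
    ENNReal.ofReal (Real.exp (-(lam * t)) * (1 - Real.exp (-(lam * t))) ^ n) •
      convPow μ₀ (n + 1)

instance isProbabilityMeasure_convPow (μ : Measure ℝ) [IsProbabilityMeasure μ] (n : ℕ) :
    IsProbabilityMeasure (convPow μ n) := by
  induction n with
  | zero => exact Measure.dirac.isProbabilityMeasure
  | succ n ih => exact Measure.probabilitymeasure_of_probabilitymeasures_conv _ _

theorem convPow_conv_convPow (μ : Measure ℝ) [IsProbabilityMeasure μ] (m n : ℕ) :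
    (convPow μ m).conv (convPow μ n) = convPow μ (m + n) := by
  induction n with
  | zero => exact Measure.conv_dirac_zero _
  | succ n ih =>
    change (convPow μ m).conv ((convPow μ n).conv μ) = (convPow μ (m + n)).conv μ
    rw [← ih, Measure.conv_assoc]

theorem convPow_one (μ : Measure ℝ) [IsProbabilityMeasure μ] : convPow μ 1 = μ :=
  Measure.dirac_zero_conv μ

/-- Convolution of two countable mixtures, evaluated on a measurable set. -/
theorem conv_sum_smul_apply (c d : ℕ → ENNReal) (μ ν : ℕ → Measure ℝ)
    [∀ n, SFinite (μ n)] [∀ n, SFinite (ν n)] {A : Set ℝ} (hA : MeasurableSet A) :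
    (Measure.conv (Measure.sum fun n => c n • μ n) (Measure.sum fun n => d n • ν n)) A =
      ∑' p : ℕ × ℕ, c p.1 * d p.2 * ((μ p.1).conv (ν p.2)) A := by
  have hadd : Measurable fun x : ℝ × ℝ => x.1 + x.2 := measurable_add
  rw [Measure.conv, Measure.prod_sum, Measure.map_sum hadd.aemeasurable,
    Measure.sum_apply _ hA]
  refine tsum_congr fun p => ?_
  rw [Measure.prod_smul_left, Measure.prod_smul_right, smul_smul, Measure.map_smul,
    Measure.smul_apply, smul_eq_mul, Measure.conv]

theorem ENNReal.tsum_prod_eq_tsum_add_one_mul (f : ℕ → ENNReal) :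
    ∑' p : ℕ × ℕ, f (p.1 + p.2) = ∑' k : ℕ, ((k : ENNReal) + 1) * f k := by
  rw [← Equiv.tsum_eq Finset.HasAntidiagonal.sigmaAntidiagonalEquivProd, ENNReal.tsum_sigma']
  refine tsum_congr fun k => ?_
  have h : ∀ b : Finset.HasAntidiagonal.antidiagonal k, f ((Finset.HasAntidiagonal.sigmaAntidiagonalEquivProd ⟨k, b⟩).1 +
      (Finset.HasAntidiagonal.sigmaAntidiagonalEquivProd ⟨k, b⟩).2) = f k := fun b => by
    rw [Finset.HasAntidiagonal.sigmaAntidiagonalEquivProd_apply, Finset.HasAntidiagonal.mem_antidiagonal.1 b.2]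
  rw [tsum_congr h, tsum_fintype]
  simp

theorem wildSum_apply (μ₀ : Measure ℝ) [IsProbabilityMeasure μ₀] {lam t : ℝ}
    (ht : 0 ≤ lam * t) {A : Set ℝ} (hA : MeasurableSet A) :
    (wildSum μ₀ lam t A).toReal = Real.exp (-(lam * t)) *
      ∑' n : ℕ, (convPow μ₀ (n + 1) A).toReal * (1 - Real.exp (-(lam * t))) ^ n := by
  have hx : 0 ≤ 1 - Real.exp (-(lam * t)) := by simpa using ht
  rw [wildSum, Measure.sum_apply _ hA, ENNReal.tsum_toReal_eq fun n => by
    rw [Measure.smul_apply, smul_eq_mul]; finiteness, ← tsum_mul_left]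
  refine tsum_congr fun n => ?_
  rw [Measure.smul_apply, smul_eq_mul, ENNReal.toReal_mul,
    ENNReal.toReal_ofReal (by positivity)]
  ring

theorem wildSum_conv_self_apply (μ₀ : Measure ℝ) [IsProbabilityMeasure μ₀] {lam t : ℝ}
    (ht : 0 ≤ lam * t) {A : Set ℝ} (hA : MeasurableSet A) :
    (((wildSum μ₀ lam t).conv (wildSum μ₀ lam t)) A).toReal = Real.exp (-(lam * t)) ^ 2 *
      ∑' n : ℕ, ((n : ℝ) + 1) * (convPow μ₀ (n + 2) A).toReal *
        (1 - Real.exp (-(lam * t))) ^ n := by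
  have hx : 0 ≤ 1 - Real.exp (-(lam * t)) := by simpa using ht
  have key : ((wildSum μ₀ lam t).conv (wildSum μ₀ lam t)) A = ∑' n : ℕ, ((n : ENNReal) + 1) *
      (ENNReal.ofReal (Real.exp (-(lam * t)) ^ 2 * (1 - Real.exp (-(lam * t))) ^ n) *
        convPow μ₀ (n + 2) A) := by
    rw [← ENNReal.tsum_prod_eq_tsum_add_one_mul (fun n => ENNReal.ofReal
      (Real.exp (-(lam * t)) ^ 2 * (1 - Real.exp (-(lam * t))) ^ n) * convPow μ₀ (n + 2) A),
      wildSum, conv_sum_smul_apply _ _ _ _ hA]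
    refine tsum_congr fun p => ?_
    rw [convPow_conv_convPow, ← ENNReal.ofReal_mul (by positivity),
      show p.1 + 1 + (p.2 + 1) = p.1 + p.2 + 2 by ring]
    congr 2
    ring
  rw [key, ENNReal.tsum_toReal_eq fun n => by finiteness, ← tsum_mul_left]
  refine tsum_congr fun n => ?_
  rw [ENNReal.toReal_mul, ENNReal.toReal_mul, ENNReal.toReal_ofReal (by positivity),
    ENNReal.toReal_add (by finiteness) (by finiteness)]
  simp only [ENNReal.toReal_natCast, ENNReal.toReal_one]
  ring

theorem isProbabilityMeasure_wildSum (μ₀ : Measure ℝ) [IsProbabilityMeasure μ₀] {lam t : ℝ}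
    (ht : 0 ≤ lam * t) : IsProbabilityMeasure (wildSum μ₀ lam t) := by
  have h := wildSum_apply μ₀ ht MeasurableSet.univ
  have hx : 0 ≤ 1 - Real.exp (-(lam * t)) := by simpa using ht
  have hx1 : 1 - Real.exp (-(lam * t)) < 1 := by linarith [Real.exp_pos (-(lam * t))]
  simp only [measure_univ, ENNReal.toReal_one, one_mul] at h
  rw [tsum_geometric_of_lt_one hx hx1, sub_sub_cancel,
    mul_inv_cancel₀ (Real.exp_pos _).ne'] at h
  exact ⟨(ENNReal.toReal_eq_one_iff _).1 h⟩

theorem summable_add_one_mul_pow {r : ℝ} (hr0 : 0 ≤ r) (hr : r < 1) :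
    Summable fun n : ℕ => ((n : ℝ) + 1) * r ^ n := by
  have hr' : ‖r‖ < 1 := by rwa [Real.norm_of_nonneg hr0]
  have h := (summable_pow_mul_geometric_of_norm_lt_one 1 hr').add
    (summable_geometric_of_lt_one hr0 hr)
  exact h.congr fun n => by ring

/-- Termwise differentiation of a power series with bounded coefficients in the unit disc. -/
theorem hasDerivAt_tsum_mul_pow {a : ℕ → ℝ} (ha : ∀ n, |a n| ≤ 1) {x : ℝ} (hx : |x| < 1) :
    HasDerivAt (fun y => ∑' n : ℕ, a n * y ^ n)
      (∑' n : ℕ, ((n : ℝ) + 1) * a (n + 1) * x ^ n) x := by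
  obtain ⟨r, hxr, hr⟩ := exists_between hx
  have hr0 : 0 ≤ r := (abs_nonneg x).trans hxr.le
  have hu : Summable fun n : ℕ => (n : ℝ) * r ^ (n - 1) := by
    rw [← summable_nat_add_iff 1]
    simpa using summable_add_one_mul_pow hr0 hr
  have hball : ∀ y ∈ Metric.ball (0 : ℝ) r, |y| ≤ r := fun y hy => by
    simpa using (Metric.mem_ball.1 hy).le
  have hbd : ∀ (n : ℕ), ∀ y ∈ Metric.ball (0 : ℝ) r,
      ‖a n * ((n : ℝ) * y ^ (n - 1))‖ ≤ (n : ℝ) * r ^ (n - 1) := fun n y hy => by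
    rw [Real.norm_eq_abs, abs_mul, abs_mul, abs_pow, Nat.abs_cast]
    have := pow_le_pow_left₀ (abs_nonneg y) (hball y hy) (n - 1)
    calc |a n| * ((n : ℝ) * |y| ^ (n - 1)) ≤ 1 * ((n : ℝ) * r ^ (n - 1)) := by
          gcongr
          exact ha n
      _ = _ := one_mul _
  have hxb : x ∈ Metric.ball (0 : ℝ) r := by simpa using hxr
  have h := hasDerivAt_tsum_of_isPreconnected (g := fun (n : ℕ) y => a n * y ^ n) hu
    Metric.isOpen_ball (convex_ball (0 : ℝ) r).isPreconnected
    (fun n y _ => (hasDerivAt_pow n y).const_mul (a n)) hbd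
    (Metric.mem_ball_self (lt_of_le_of_lt (abs_nonneg x) hxr))
    (summable_of_ne_finset_zero (s := {0}) fun n hn => by
      simp [show n ≠ 0 by simpa using hn]) hxb
  have hs : Summable fun n : ℕ => a n * ((n : ℝ) * x ^ (n - 1)) :=
    Summable.of_norm_bounded hu fun n => hbd n x hxb
  rw [hs.tsum_eq_zero_add] at h
  simp only [Nat.cast_zero, zero_mul, mul_zero, zero_add, Nat.cast_add, Nat.cast_one,
    add_tsub_cancel_right] at h
  exact h.congr_deriv (tsum_congr fun n => by ring)

theorem continuousOn_tsum_add_one_mul_pow {a : ℕ → ℝ} (ha : ∀ n, |a n| ≤ 1) {r : ℝ}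
    (hr0 : 0 ≤ r) (hr : r < 1) :
    ContinuousOn (fun y => ∑' n : ℕ, ((n : ℝ) + 1) * a (n + 1) * y ^ n) (Set.Icc 0 r) := by
  refine continuousOn_tsum (fun n => by fun_prop) (summable_add_one_mul_pow hr0 hr)
    fun n y hy => ?_
  rw [Real.norm_eq_abs, abs_mul, abs_mul, abs_pow, abs_of_nonneg hy.1,
    abs_of_nonneg (by positivity : (0 : ℝ) ≤ (n : ℝ) + 1)]
  have := pow_le_pow_left₀ hy.1 hy.2 n
  have h0 := hy.1
  calc ((n : ℝ) + 1) * |a (n + 1)| * y ^ n ≤ ((n : ℝ) + 1) * 1 * r ^ n := by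
        gcongr
        exact ha _
    _ = _ := by rw [mul_one]

/-- **Proposition 1, existence.** The Wild sum is a probability measure for
every `t ≥ 0` and solves the evolution equation
`μ_t(A) = μ₀(A) + λ ∫₀ᵗ ((μ_s ∗ μ_s)(A) − μ_s(A)) ds`. -/
theorem wildSum_isProbability_and_solves_evolution
    (μ₀ : Measure ℝ) [IsProbabilityMeasure μ₀] (lam : ℝ) (hlam : 0 < lam) :
    (∀ t ≥ (0 : ℝ), IsProbabilityMeasure (wildSum μ₀ lam t)) ∧
    (∀ A : Set ℝ, MeasurableSet A → ∀ t ≥ (0 : ℝ),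
      ((wildSum μ₀ lam t) A).toReal =
        (μ₀ A).toReal +
          lam * ∫ s in (0 : ℝ)..t,
            ((Measure.conv (wildSum μ₀ lam s) (wildSum μ₀ lam s)) A).toReal -
              ((wildSum μ₀ lam s) A).toReal) := by
  refine ⟨fun t ht => isProbabilityMeasure_wildSum μ₀ (mul_nonneg hlam.le ht),
    fun A hA t ht => ?_⟩
  set a : ℕ → ℝ := fun n => (convPow μ₀ (n + 1) A).toReal with ha_def
  have ha : ∀ n, |a n| ≤ 1 := fun n => by
    rw [abs_of_nonneg ENNReal.toReal_nonneg]
    exact ENNReal.toReal_le_of_le_ofReal zero_le_one (by simpa using prob_le_one)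
  set E : ℝ → ℝ := fun s => Real.exp (-(lam * s)) with hE_def
  set G : ℝ → ℝ := fun y => ∑' n : ℕ, a n * y ^ n with hG_def
  set H : ℝ → ℝ := fun y => ∑' n : ℕ, ((n : ℝ) + 1) * a (n + 1) * y ^ n with hH_def
  have hE0 : ∀ s, 0 < E s := fun s => Real.exp_pos _
  have hE1 : ∀ s, 0 ≤ s → E s ≤ 1 := fun s hs =>
    Real.exp_le_one_iff.2 (by have := mul_nonneg hlam.le hs; linarith)
  have hEc : Continuous E := by fun_prop
  have hW : ∀ s, 0 ≤ s → (wildSum μ₀ lam s A).toReal = E s * G (1 - E s) := fun s hs =>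
    wildSum_apply μ₀ (mul_nonneg hlam.le hs) hA
  have hC : ∀ s, 0 ≤ s → (((wildSum μ₀ lam s).conv (wildSum μ₀ lam s)) A).toReal =
      E s ^ 2 * H (1 - E s) := fun s hs =>
    wildSum_conv_self_apply μ₀ (mul_nonneg hlam.le hs) hA
  have habs : ∀ s, 0 ≤ s → |1 - E s| < 1 := fun s hs => by
    rw [abs_of_nonneg (by linarith [hE1 s hs])]
    linarith [hE0 s]
  have hderiv : ∀ s ∈ Set.uIcc 0 t, HasDerivAt (fun s => E s * G (1 - E s))
      (lam * (E s ^ 2 * H (1 - E s) - E s * G (1 - E s))) s := fun s hs => by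
    rw [Set.uIcc_of_le ht] at hs
    have h1 : HasDerivAt E (-lam * E s) s := by
      have := (((hasDerivAt_id s).const_mul lam).neg).exp
      exact this.congr_deriv (by simp [hE_def]; ring)
    have h2 : HasDerivAt (fun s => G (1 - E s)) (H (1 - E s) * -(-lam * E s)) s :=
      HasDerivAt.comp (h₂ := G) s (hasDerivAt_tsum_mul_pow ha (habs s hs.1)) (h1.const_sub 1)
    exact (h1.mul h2).congr_deriv (by ring)
  have hHc : ContinuousOn (fun s => H (1 - E s)) (Set.uIcc 0 t) := by
    rw [Set.uIcc_of_le ht]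
    refine (continuousOn_tsum_add_one_mul_pow ha (r := 1 - E t) (by linarith [hE1 t ht])
      (by linarith [hE0 t])).comp (by fun_prop) fun s hs => ⟨by linarith [hE1 s hs.1], ?_⟩
    have : E t ≤ E s := Real.exp_le_exp.2 (by
      have := mul_le_mul_of_nonneg_left hs.2 hlam.le
      linarith)
    linarith
  have hFc : ContinuousOn (fun s => E s * G (1 - E s)) (Set.uIcc 0 t) :=
    HasDerivAt.continuousOn hderiv
  have hint := intervalIntegral.integral_eq_sub_of_hasDerivAt hderiv
    (ContinuousOn.intervalIntegrable
      (continuousOn_const.mul (((hEc.pow 2).continuousOn.mul hHc).sub hFc)))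
  have h0 : E 0 * G (1 - E 0) = (μ₀ A).toReal := by
    rw [hG_def, hE_def]
    simp only [mul_zero, neg_zero, Real.exp_zero, sub_self, one_mul]
    rw [tsum_eq_single 0 fun n hn => by simp [hn]]
    simp [ha_def, convPow_one]
  rw [intervalIntegral.integral_congr (g := fun s => E s ^ 2 * H (1 - E s) - E s * G (1 - E s))
    fun s hs => by
      rw [Set.uIcc_of_le ht] at hs
      simp only [hW s hs.1, hC s hs.1],
    ← intervalIntegral.integral_const_mul, hint, h0, hW t ht]
  ring
end

section
/- Fix an integer m ≥ 2 and let b : ℕ → ℝ be defined by b(1) = 1 and, for n > 1, b(n) = (m−1)^{−1} ( 1 − Σ_{(i₁,…,i_{m−1}): each i_k < n, Σ i_k = n+m−2} ∏_{k=1}^{m−1} b(i_k) ). Then for every u ∈ (0,1], the series Σ_{n≥1} b(n) · u · (1 − u^{m−1})^{n−1} converges and its sum equals 1. -/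
open Finset PowerSeries

/-- The coefficient of `X ^ n` in `A ^ p`, for `A` with constant coefficient `1` and `n ≠ 0`, with
the `p` occurrences of the coefficient of `X ^ n` in `A` separated from the lower ones. -/
theorem coeff_pow_eq_mul_add_sum_lt (A : ℝ⟦X⟧) (hA : coeff 0 A = 1) (p n : ℕ) (hn : n ≠ 0) :
    coeff n (A ^ p) = p * coeff n A +
      ∑ l ∈ (finsuppAntidiag (univ : Finset (Fin p)) n).filter (fun l => ∀ k, l k < n),
        ∏ k, coeff (l k) A := by
  have hprod : A ^ p = ∏ _k : Fin p, A := by simp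
  rw [hprod, coeff_prod, ← sum_filter_not_add_sum_filter _ (fun l => ∀ k, l k < n)]
  congr 1
  have hsingle : (finsuppAntidiag (univ : Finset (Fin p)) n).filter (fun l => ¬ ∀ k, l k < n) =
      univ.image (fun k => Finsupp.single k n) := by
    ext l
    simp only [mem_filter, mem_finsuppAntidiag, subset_univ, and_true, not_forall, not_lt,
      mem_image, mem_univ, true_and]
    constructor
    · rintro ⟨hsum, k, hk⟩
      refine ⟨k, ?_⟩
      rw [← add_sum_erase _ _ (mem_univ k)] at hsum
      have hzero : ∑ x ∈ univ.erase k, l x = 0 := by omega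
      rw [sum_eq_zero_iff] at hzero
      ext x
      by_cases hx : k = x
      · subst hx
        simp only [Finsupp.single_eq_same]
        omega
      · rw [Finsupp.single_apply, if_neg hx]
        exact (hzero x (by simp [Ne.symm hx])).symm
    · rintro ⟨k, rfl⟩
      refine ⟨by simp [Finsupp.single_apply], k, by simp⟩
  rw [hsingle, sum_image fun x _ y _ h => Finsupp.single_left_injective hn h]
  have hterm (k : Fin p) : ∏ x, coeff ((Finsupp.single k n) x) A = coeff n A := by
    rw [prod_eq_single k]
    · simp
    · intro x _ hx
      rw [Finsupp.single_eq_of_ne hx, hA]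
    · simp
  simp [hterm]

/-- Power series with constant coefficient `1` are determined by any positive power. -/
theorem eq_of_pow_eq_of_constantCoeff_eq_one {A B : ℝ⟦X⟧} {p : ℕ} (hp : p ≠ 0)
    (hA : constantCoeff A = 1) (hB : constantCoeff B = 1) (h : A ^ p = B ^ p) : A = B := by
  have hmul := (Commute.all A B).geom_sum₂_mul p
  rw [h, sub_self, mul_eq_zero] at hmul
  rcases hmul with hsum | hsub
  · have := congrArg constantCoeff hsum
    simp [hA, hB, hp] at this
  · exact sub_eq_zero.mp hsub

/-- The series `(1 - X) ^ (-1 / p)` is a `p`-th root of the geometric series. -/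
theorem rescale_binomialSeries_pow (p : ℕ) (hp : p ≠ 0) :
    (rescale (-1 : ℝ) (PowerSeries.binomialSeries ℝ (-(p : ℝ)⁻¹))) ^ p = PowerSeries.mk 1 := by
  have hpow (r : ℝ) (q : ℕ) : (PowerSeries.binomialSeries ℝ r) ^ q =
      PowerSeries.binomialSeries ℝ (q * r) := by
    induction q with
    | zero => simp
    | succ q ih => rw [pow_succ, ih, ← binomialSeries_add]; congr 1; push_cast; ring
  have hp' : (p : ℝ) ≠ 0 := by exact_mod_cast hp
  have hinv : PowerSeries.binomialSeries ℝ (-1 : ℝ) * (1 + X) = 1 := by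
    have h := binomialSeries_nat (R := ℝ) (A := ℝ) 1
    rw [pow_one] at h
    rw [← h, ← binomialSeries_add]
    simp
  have hresc := congrArg (rescale (-1 : ℝ)) hinv
  rw [map_mul, map_add, map_one, rescale_neg_one_X, ← sub_eq_add_neg] at hresc
  rw [← map_pow, hpow, mul_neg, mul_inv_cancel₀ hp']
  have hne : (1 - X : ℝ⟦X⟧) ≠ 0 := by
    intro h0
    simp [h0] at hresc
  exact mul_right_cancel₀ hne (hresc.trans (mk_one_mul_one_sub_eq_one ℝ).symm)

/-- The binomial expansion of `(1 - x) ^ (-1 / p)` at `x = 1 - u ^ p`. -/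
theorem hasSum_rescale_binomialSeries (p : ℕ) (hp : p ≠ 0) (u : ℝ) (hu : u ∈ Set.Ioc (0 : ℝ) 1) :
    HasSum (fun n : ℕ => coeff n (rescale (-1 : ℝ) (PowerSeries.binomialSeries ℝ (-(p : ℝ)⁻¹))) *
      (1 - u ^ p) ^ n) u⁻¹ := by
  obtain ⟨hu0, hu1⟩ := hu
  have hpos : 0 < u ^ p := pow_pos hu0 p
  have hle : u ^ p ≤ 1 := pow_le_one₀ hu0.le hu1
  have hmem : -(1 - u ^ p) ∈ Metric.eball (0 : ℝ) 1 := by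
    rw [← ENNReal.ofReal_one, Metric.eball_ofReal, mem_ball_zero_iff, Real.norm_eq_abs, abs_lt]
    constructor <;> linarith
  have h := (Real.one_add_rpow_hasFPowerSeriesOnBall_zero (a := -(p : ℝ)⁻¹)).hasSum hmem
  have hval : (1 + (0 + -(1 - u ^ p))) ^ (-(p : ℝ)⁻¹) = u⁻¹ := by
    rw [show 1 + (0 + -(1 - u ^ p)) = u ^ p by ring, Real.rpow_neg hpos.le,
      Real.pow_rpow_inv_natCast hu0.le hp]
  rw [hval] at h
  refine h.congr_fun fun n => ?_
  have hneg : (-(1 - u ^ p)) ^ n = (-1) ^ n * (1 - u ^ p) ^ n := neg_pow _ _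
  rw [coeff_rescale, PowerSeries.binomialSeries_coeff, binomialSeries_apply, List.ofFn_const,
    List.prod_replicate, hneg]
  simp only [smul_eq_mul]
  ring

/-- Shifting every index by one turns tuples with entries in `[1, n]` and sum `n + p` into tuples
with entries below `n` and sum `n`. -/
theorem sum_piFinset_Ico_eq_sum_finsuppAntidiag (b : ℕ → ℝ) (p n : ℕ) :
    ∑ i ∈ (Fintype.piFinset fun _ : Fin p => Ico 1 (n + 1)).filter
        (fun i => ∑ k, i k = n + p), ∏ k, b (i k) =
      ∑ l ∈ (finsuppAntidiag (univ : Finset (Fin p)) n).filter (fun l => ∀ k, l k < n),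
        ∏ k, b (l k + 1) := by
  refine sum_nbij' (fun i => Finsupp.equivFunOnFinite.symm fun k => i k - 1)
    (fun l k => l k + 1) ?_ ?_ ?_ ?_ ?_
  · intro i hi
    simp only [mem_filter, Fintype.mem_piFinset, mem_Ico] at hi
    obtain ⟨hi, hsum⟩ := hi
    have hshift : ∑ k, i k = ∑ k, (i k - 1) + p := by
      rw [← sum_congr rfl fun k _ => Nat.sub_add_cancel (hi k).1, sum_add_distrib]
      simp
    simp only [mem_filter, mem_finsuppAntidiag, subset_univ, and_true,
      Finsupp.equivFunOnFinite_symm_apply_apply]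
    exact ⟨by omega, fun k => by have := hi k; omega⟩
  · intro l hl
    simp only [mem_filter, mem_finsuppAntidiag, subset_univ, and_true] at hl
    simp only [mem_filter, Fintype.mem_piFinset, mem_Ico]
    refine ⟨fun k => ⟨by omega, by have := hl.2 k; omega⟩, ?_⟩
    simp [sum_add_distrib, hl.1]
  · intro i hi
    simp only [mem_filter, Fintype.mem_piFinset, mem_Ico] at hi
    ext k
    have := hi.1 k
    simp
    omega
  · intro l _
    ext k
    simp
  · intro i hi
    simp only [mem_filter, Fintype.mem_piFinset, mem_Ico] at hi
    refine prod_congr rfl fun k _ => ?_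
    simp [Nat.sub_add_cancel (hi.1 k).1]

/-- With the Wild coefficients `b` for the `m`-agent model
(`b(1) = 1` and, for `n > 1`,
`b(n) = (m−1)⁻¹ (1 − Σ_{(i₁,…,i_{m−1}): i_k < n, Σ i_k = n+m−2} ∏ b(i_k))`), for every
`u ∈ (0,1]` the series `Σ_{n≥1} b(n)·u·(1−u^{m−1})^{n−1}` converges with sum `1`. -/
theorem wild_series_total_mass_one (m : ℕ) (hm : 2 ≤ m) (b : ℕ → ℝ)
    (hb1 : b 1 = 1)
    (hbrec : ∀ n > 1, b n =
      ((m : ℝ) - 1)⁻¹ *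
        (1 - ∑ i ∈ (Fintype.piFinset fun _ : Fin (m - 1) => Finset.Ico 1 n).filter
              (fun i => ∑ k, i k = n + m - 2),
            ∏ k, b (i k))) :
    ∀ u : ℝ, u ∈ Set.Ioc (0 : ℝ) 1 →
      HasSum (fun n : ℕ => b (n + 1) * u * (1 - u ^ (m - 1)) ^ n) 1 := by
  intro u hu
  obtain ⟨p, rfl⟩ : ∃ p, m = p + 1 := ⟨m - 1, by omega⟩
  have hp : p ≠ 0 := by omega
  have hp' : (p : ℝ) ≠ 0 := by exact_mod_cast hp
  simp only [Nat.add_sub_cancel, Nat.cast_add, Nat.cast_one, add_sub_cancel_right] at hbrec ⊢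
  let A : ℝ⟦X⟧ := PowerSeries.mk fun n => b (n + 1)
  have hA0 : coeff 0 A = 1 := by simp [A, hb1]
  have hApow : A ^ p = PowerSeries.mk 1 := by
    ext n
    rcases Nat.eq_zero_or_pos n with rfl | hn
    · rw [coeff_zero_eq_constantCoeff_apply] at hA0
      simp [hA0]
    · rw [coeff_pow_eq_mul_add_sum_lt A hA0 p n hn.ne']
      have hrec := hbrec (n + 1) (by omega)
      rw [show n + 1 + (p + 1) - 2 = n + p by omega] at hrec
      simp only [A, coeff_mk, Pi.one_apply]
      rw [hrec.trans (congrArg (fun s => (p : ℝ)⁻¹ * (1 - s))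
          (sum_piFinset_Ico_eq_sum_finsuppAntidiag b p n)), mul_inv_cancel_left₀ hp', sub_add_cancel]
  have hA : A = rescale (-1 : ℝ) (PowerSeries.binomialSeries ℝ (-(p : ℝ)⁻¹)) := by
    refine eq_of_pow_eq_of_constantCoeff_eq_one hp
      (by simpa using hA0) ?_ (hApow.trans (rescale_binomialSeries_pow p hp).symm)
    rw [← coeff_zero_eq_constantCoeff_apply, coeff_rescale]
    simp
  have h := (hasSum_rescale_binomialSeries p hp u hu).mul_left u
  rw [← hA, mul_inv_cancel₀ hu.1.ne'] at h
  exact h.congr_fun fun n => by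
    simp only [A, coeff_mk]
    ring
end

section
/- Let k ≥ 1 be an integer and let μ, ν be Borel probability measures on ℝ whose moment generating functions s ↦ ∫ e^{s x} dμ(x) and s ↦ ∫ e^{s x} dν(x) are both finite on some neighborhood of 0. If μ^{*k} = ν^{*k}, then μ = ν. In other words, a probability measure on ℝ with a moment generating function finite near zero is uniquely determined by its k-fold convolution power. -/
open MeasureTheory

open ProbabilityTheory in
/-- Two probability measures on `ℝ` with the same moment generating function are equal, provided
the moment generating function is finite on a neighborhood of `0`. -/
theorem ext_of_mgf_id_eq {μ ν : Measure ℝ} [IsProbabilityMeasure μ] [IsFiniteMeasure ν]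
    (h0 : 0 ∈ interior (integrableExpSet id μ)) (h : mgf id μ = mgf id ν) : μ = ν := by
  refine Measure.ext_of_charFun (funext fun t ↦ ?_)
  rw [← complexMGF_id_mul_I, ← complexMGF_id_mul_I]
  exact eqOn_complexMGF_of_mgf h (by simpa using h0)

theorem lintegral_exp_mul_convPow (μ : Measure ℝ) [SFinite μ] (s : ℝ) (n : ℕ) :
    ∫⁻ x, ENNReal.ofReal (Real.exp (s * x)) ∂(convPow μ n) =
      (∫⁻ x, ENNReal.ofReal (Real.exp (s * x)) ∂μ) ^ n := by
  induction n with
  | zero => simp [convPow]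
  | succ n ih =>
    rw [convPow, Measure.lintegral_conv (by fun_prop), pow_succ, ← ih,
      ← lintegral_mul_const _ (by fun_prop)]
    refine lintegral_congr fun x ↦ ?_
    rw [← lintegral_const_mul _ (by fun_prop)]
    refine lintegral_congr fun y ↦ ?_
    rw [mul_add, Real.exp_add, ENNReal.ofReal_mul (Real.exp_nonneg _)]

/-- A Borel probability measure on `ℝ` whose moment generating
function is finite on a neighborhood of `0` is uniquely determined by its `k`-fold
convolution power (`k ≥ 1`). -/
theorem eq_of_convPow_eq (k : ℕ) (hk : 1 ≤ k)
    (μ ν : Measure ℝ) [IsProbabilityMeasure μ] [IsProbabilityMeasure ν]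
    (hμmgf : ∃ ε > (0 : ℝ), ∀ s : ℝ, |s| < ε → Integrable (fun x : ℝ => Real.exp (s * x)) μ)
    (hνmgf : ∃ ε > (0 : ℝ), ∀ s : ℝ, |s| < ε → Integrable (fun x : ℝ => Real.exp (s * x)) ν)
    (h : convPow μ k = convPow ν k) : μ = ν := by
  obtain ⟨ε, hε, hint⟩ := hμmgf
  have h0 : 0 ∈ interior (ProbabilityTheory.integrableExpSet id μ) := by
    refine mem_interior_iff_mem_nhds.2 (Metric.mem_nhds_iff.2 ⟨ε, hε, fun s hs ↦ hint s ?_⟩)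
    simpa using hs
  refine ext_of_mgf_id_eq h0 (funext fun s ↦ ?_)
  have hpow := congrArg (fun ρ ↦ ∫⁻ x, ENNReal.ofReal (Real.exp (s * x)) ∂ρ) h
  simp only [lintegral_exp_mul_convPow] at hpow
  have hlint := (ENNReal.pow_right_strictMono (Nat.one_le_iff_ne_zero.1 hk)).injective hpow
  simp only [ProbabilityTheory.mgf, id]
  rw [integral_eq_lintegral_of_nonneg_ae (.of_forall fun _ ↦ Real.exp_nonneg _) (by fun_prop),
    integral_eq_lintegral_of_nonneg_ae (.of_forall fun _ ↦ Real.exp_nonneg _) (by fun_prop), hlint]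
end
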